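/- Let A, B ∈ ℝ^{3×3} be polytropes with A ⊙ B = B ⊙ A. Then A ⊙ B = A ⊕ B, i.e. min_{s=1..3}(A_{is} + B_{sj}) = min(A_{ij}, B_{ij}) for all i, j. -/

import Mathlib

namespace TropComm

variable {n : ℕ}

/-- Tropical (min-plus) matrix product: `(A ⊙ B) i j = min_s (A i s + B s j)`. -/
def tropMul [NeZero n] (A B : Fin n → Fin n → ℝ) : Fin n → Fin n → ℝ :=
  fun i j => Finset.univ.inf' Finset.univ_nonempty (fun s => A i s + B s j)

/-- Tropical matrix-vector product: `(A ⊙ x) i = min_j (A i j + x j)`. -/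
def tropMulVec [NeZero n] (A : Fin n → Fin n → ℝ) (x : Fin n → ℝ) : Fin n → ℝ :=
  fun i => Finset.univ.inf' Finset.univ_nonempty (fun j => A i j + x j)

/-- Tropical sum: entrywise minimum. -/
def tropSum (A B : Fin n → Fin n → ℝ) : Fin n → Fin n → ℝ :=
  fun i j => min (A i j) (B i j)

/-- `tropPow A k` is the k-fold tropical product `A^{⊙k}` (with the junk value
`tropPow A 0 = A`; only exponents `k ≥ 1` are ever used). -/
def tropPow [NeZero n] (A : Fin n → Fin n → ℝ) : ℕ → (Fin n → Fin n → ℝ)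
  | 0 => A
  | 1 => A
  | (k + 2) => tropMul A (tropPow A (k + 1))

/-- Kleene star `A* = A ⊕ A^{⊙2} ⊕ ⋯ ⊕ A^{⊙n}`. -/
def kleene [NeZero n] (A : Fin n → Fin n → ℝ) : Fin n → Fin n → ℝ :=
  fun i j => Finset.univ.inf' Finset.univ_nonempty (fun k : Fin n => tropPow A (k.val + 1) i j)

/-- A premetric: zero diagonal, positive off-diagonal entries. -/
def IsPremetric (A : Fin n → Fin n → ℝ) : Prop :=
  (∀ i, A i i = 0) ∧ ∀ i j, i ≠ j → 0 < A i j

/-- A polytrope: a premetric satisfying the triangle inequality. -/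
def IsPolytrope (A : Fin n → Fin n → ℝ) : Prop :=
  IsPremetric A ∧ ∀ i j k, A i j ≤ A i k + A k j


theorem tropMul_le [NeZero n] (A B : Fin n → Fin n → ℝ) (i j s : Fin n) :
    tropMul A B i j ≤ A i s + B s j :=
  Finset.inf'_le (fun s => A i s + B s j) (Finset.mem_univ s)

theorem exists_tropMul_eq [NeZero n] (A B : Fin n → Fin n → ℝ) (i j : Fin n) :
    ∃ s, tropMul A B i j = A i s + B s j := by
  obtain ⟨s, -, hs⟩ :=
    Finset.exists_mem_eq_inf' Finset.univ_nonempty (fun s => A i s + B s j)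
  exact ⟨s, hs⟩

theorem IsPolytrope.nonneg {A : Fin n → Fin n → ℝ} (hA : IsPolytrope A) (i j : Fin n) :
    0 ≤ A i j := by
  by_cases hij : i = j
  · rw [hij, hA.1.1]
  · exact (hA.1.2 i j hij).le

theorem tropMul_le_tropSum [NeZero n] {A B : Fin n → Fin n → ℝ}
    (hA : IsPremetric A) (hB : IsPremetric B) (i j : Fin n) :
    tropMul A B i j ≤ tropSum A B i j := by
  refine le_min ?_ ?_
  · simpa [hB.1 j] using tropMul_le A B i j j
  · simpa [hA.1 i] using tropMul_le A B i j i

/-- For 3×3 polytropes `A, B` with `A ⊙ B = B ⊙ A`,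
we have `A ⊙ B = A ⊕ B`. -/
theorem stmt4 (A B : Fin 3 → Fin 3 → ℝ)
    (hA : IsPolytrope A) (hB : IsPolytrope B)
    (h : tropMul A B = tropMul B A) :
    tropMul A B = tropSum A B := by
  funext i j
  refine le_antisymm (tropMul_le_tropSum hA.1 hB.1 i j) ?_
  obtain ⟨s, hs⟩ := exists_tropMul_eq A B i j
  obtain ⟨t, ht⟩ := exists_tropMul_eq B A i j
  have hst : A i s + B s j = B i t + A t j := by rw [← hs, ← ht, h]
  rw [hs]
  by_contra! hlt
  obtain ⟨hltA, hltB⟩ := lt_min_iff.mp hlt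
  have hij : i ≠ j := by
    rintro rfl
    linarith [hA.1.1 i, hA.nonneg i s, hB.nonneg s i]
  have hsi : s ≠ i := by
    rintro rfl
    linarith [hA.1.1 s]
  have hsj : s ≠ j := by
    rintro rfl
    linarith [hB.1.1 s]
  have hti : t ≠ i := by
    rintro rfl
    linarith [hB.1.1 t]
  have htj : t ≠ j := by
    rintro rfl
    linarith [hA.1.1 t]
  obtain rfl : t = s := by omega
  linarith [hA.2 i j t, hB.2 i j t]

end TropComm
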